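/- For T > 0 and d ≥ 1, let h : ℝ^d → ℝ be Lebesgue measurable with polynomial growth, i.e. there are constants a ≥ 0 and m ∈ ℕ with |h(u)| ≤ a(1+|u|)^m for all u ∈ ℝ^d; define the Gaussian convolution v : (0,T)×ℝ^d → ℝ by v(t,x) = (2π(T−t))^{−d/2} ∫_{ℝ^d} h(u) exp(−|u−x|²/(2(T−t))) du. Let Ω = {(t+iτ, x+iy) ∈ ℂ × ℂ^d : 0 < t < T, x ∈ ℝ^d, |τ| < T−t, |y| < √(T−t)}. Then for every (𝐭,𝐱) ∈ Ω the integral V(𝐭,𝐱) = (2π(T−𝐭))^{−d/2} ∫_{ℝ^d} h(u) exp(−Σ_{j=1}^d (u_j−𝐱_j)²/(2(T−𝐭))) du converges absolutely (using the principal branch of the power (T−𝐭)^{−d/2}), V is holomorphic (complex analytic) on Ω, and V(t,x) = v(t,x) for all real (t,x) ∈ (0,T)×ℝ^d. -/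

import Mathlib

open MeasureTheory Set Real

/-- A Laplace-type integral is analytic as soon as it converges with some room. -/
theorem laplace_analyticAt {d : ℕ} {E : Type*} [NormedAddCommGroup E] [NormedSpace ℂ E]
    (H : (Fin d → ℝ) → ℂ) (hH : Measurable H)
    (L : (Fin d → ℝ) → E →L[ℂ] ℂ) (hL : Continuous L) (q : E) (r : ℝ) (hr : 0 < r)
    (hint : Integrable (fun u => ‖H u * Complex.exp (L u q)‖ * Real.exp (r * ‖L u‖))) :
    AnalyticAt ℂ (fun z => ∫ u, H u * Complex.exp (L u z)) q := by
  set f : (Fin d → ℝ) → ℂ := fun u => H u * Complex.exp (L u q) with hf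
  have hfm : Measurable f := by
    have : Continuous fun u => Complex.exp (L u q) := by fun_prop
    exact hH.mul this.measurable
  let M : (n : ℕ) → (Fin d → ℝ) → ContinuousMultilinearMap ℂ (fun _ : Fin n => E) ℂ :=
    fun n u => (ContinuousMultilinearMap.mkPiAlgebraFin ℂ n ℂ).compContinuousLinearMap
      (fun _ => L u)
  have hMc : ∀ n, Continuous (M n) := by
    intro n
    have h1 := (ContinuousMultilinearMap.compContinuousLinearMapContinuousMultilinear ℂ
      (fun _ : Fin n => E) (fun _ : Fin n => ℂ) ℂ).cont
    have h2 : Continuous fun u : Fin d → ℝ => (fun _ : Fin n => L u) := by fun_prop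
    exact (h1.comp h2).clm_apply continuous_const
  have hMn : ∀ n u, ‖M n u‖ ≤ ‖L u‖ ^ n := by
    intro n u
    refine (ContinuousMultilinearMap.norm_compContinuousLinearMap_le _ _).trans ?_
    simp
  have hMa : ∀ n u y, M n u (fun _ => y) = (L u y) ^ n := by
    intro n u y
    simp [M, List.ofFn_const]
  let G : (n : ℕ) → (Fin d → ℝ) → ContinuousMultilinearMap ℂ (fun _ : Fin n => E) ℂ :=
    fun n u => (f u * ((n.factorial : ℂ))⁻¹) • M n u
  have hGm : ∀ n, AEStronglyMeasurable (G n) volume := by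
    intro n
    exact (hfm.mul_const _).aestronglyMeasurable.smul (hMc n).aestronglyMeasurable
  have hGn : ∀ n u, ‖G n u‖ * r ^ n ≤ ‖f u‖ * ((r * ‖L u‖) ^ n / n.factorial) := by
    intro n u
    simp only [G, norm_smul, norm_mul, norm_inv, Complex.norm_natCast]
    have := hMn n u
    rw [mul_pow]
    calc ‖f u‖ * (n.factorial : ℝ)⁻¹ * ‖M n u‖ * r ^ n
        ≤ ‖f u‖ * (n.factorial : ℝ)⁻¹ * ‖L u‖ ^ n * r ^ n := by gcongr
      _ = _ := by ring
  have hpe : ∀ n u, ‖f u‖ * ((r * ‖L u‖) ^ n / n.factorial) ≤ ‖f u‖ * Real.exp (r * ‖L u‖) := by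
    intro n u
    gcongr
    exact Real.pow_div_factorial_le_exp _ (by positivity) n
  have hGi : ∀ n, Integrable (G n) := by
    intro n
    refine (hint.mul_const (r ^ n)⁻¹).mono' (hGm n) (Filter.Eventually.of_forall fun u => ?_)
    rw [← div_eq_mul_inv, le_div_iff₀ (by positivity)]
    exact (hGn n u).trans (hpe n u)
  let p : FormalMultilinearSeries ℂ E ℂ := fun n => ∫ u, G n u
  have hp : HasFPowerSeriesOnBall (fun z => ∫ u, H u * Complex.exp (L u z)) p q
      (ENNReal.ofReal r) := by
    refine ⟨?_, by simpa using hr, ?_⟩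
    · refine p.le_radius_of_bound (r := r.toNNReal) (∫ u, ‖f u‖ * Real.exp (r * ‖L u‖)) ?_
      intro n
      rw [Real.coe_toNNReal _ hr.le]
      calc ‖p n‖ * r ^ n ≤ (∫ u, ‖G n u‖) * r ^ n := by
            gcongr; exact norm_integral_le_integral_norm _
        _ = ∫ u, ‖G n u‖ * r ^ n := (integral_mul_const _ _).symm
        _ ≤ _ := integral_mono ((hGi n).norm.mul_const _) hint
            fun u => (hGn n u).trans (hpe n u)
    · intro y hy
      have hy' : ‖y‖ < r := by
        rw [Metric.eball_ofReal] at hy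
        simpa using hy
      have h1 : ∀ n, p n (fun _ => y) = ∫ u, f u * ((L u y) ^ n / n.factorial) := by
        intro n
        simp only [p]
        rw [ContinuousMultilinearMap.integral_apply (hGi n)]
        congr 1 with u
        simp only [G, ContinuousMultilinearMap.smul_apply, hMa, smul_eq_mul]
        ring
      simp only [h1]
      have hsr : ∀ u, HasSum (fun n : ℕ => ‖f u‖ * ((r * ‖L u‖) ^ n / n.factorial))
          (‖f u‖ * Real.exp (r * ‖L u‖)) := by
        intro u
        refine HasSum.mul_left _ ?_
        rw [Real.exp_eq_exp_ℝ]
        exact NormedSpace.expSeries_div_hasSum_exp _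
      refine hasSum_integral_of_dominated_convergence
        (fun n u => ‖f u‖ * ((r * ‖L u‖) ^ n / n.factorial)) ?_ ?_ ?_ ?_ ?_
      · intro n
        have : Continuous fun u => (L u y) ^ n / (n.factorial : ℂ) := by fun_prop
        exact (hfm.mul this.measurable).aestronglyMeasurable
      · intro n
        refine Filter.Eventually.of_forall fun u => ?_
        simp only [norm_mul, norm_div, norm_pow, Complex.norm_natCast]
        have : ‖L u y‖ ≤ r * ‖L u‖ := by
          calc ‖L u y‖ ≤ ‖L u‖ * ‖y‖ := (L u).le_opNorm y
            _ ≤ ‖L u‖ * r := by gcongr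
            _ = _ := by ring
        gcongr
      · exact Filter.Eventually.of_forall fun u => (hsr u).summable
      · simpa only [(hsr _).tsum_eq] using hint
      · refine Filter.Eventually.of_forall fun u => ?_
        have : H u * Complex.exp (L u (q + y)) = f u * Complex.exp (L u y) := by
          simp only [hf, map_add, Complex.exp_add]; ring
        rw [this]
        refine HasSum.mul_left _ ?_
        rw [Complex.exp_eq_exp_ℂ]
        exact NormedSpace.expSeries_div_hasSum_exp _
  exact hp.analyticAt

/-- The linear functional `(s, w) ↦ -s |u|² + 2 u ⬝ w`. -/
noncomputable def lapFun (d : ℕ) (u : Fin d → ℝ) : (ℂ × (Fin d → ℂ)) →L[ℂ] ℂ :=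
  (-(∑ j, (u j : ℂ) ^ 2)) • ContinuousLinearMap.fst ℂ ℂ (Fin d → ℂ) +
    ∑ j, (2 * (u j : ℂ)) • ((ContinuousLinearMap.proj (R := ℂ) (φ := fun _ : Fin d => ℂ) j).comp
      (ContinuousLinearMap.snd ℂ ℂ (Fin d → ℂ)))

theorem lapFun_apply (d : ℕ) (u : Fin d → ℝ) (q : ℂ × (Fin d → ℂ)) :
    lapFun d u q = -(∑ j, (u j : ℂ) ^ 2) * q.1 + ∑ j, 2 * (u j : ℂ) * q.2 j := by
  simp [lapFun]

theorem lapFun_continuous (d : ℕ) : Continuous (lapFun d) := by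
  unfold lapFun
  fun_prop

theorem abs_coord_le {d : ℕ} (u : Fin d → ℝ) (j : Fin d) : |u j| ≤ √(∑ j, u j ^ 2) := by
  apply Real.abs_le_sqrt
  exact Finset.single_le_sum (f := fun j => u j ^ 2) (fun i _ => sq_nonneg _) (Finset.mem_univ j)

theorem lapFun_norm (d : ℕ) (u : Fin d → ℝ) :
    ‖lapFun d u‖ ≤ (∑ j, u j ^ 2) + 2 * d * √(∑ j, u j ^ 2) := by
  have hS : 0 ≤ ∑ j, u j ^ 2 := Finset.sum_nonneg fun i _ => sq_nonneg _
  refine ContinuousLinearMap.opNorm_le_bound _ (by positivity) fun q => ?_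
  rw [lapFun_apply]
  refine (norm_add_le _ _).trans ?_
  rw [add_mul]
  have h1 : ‖-(∑ j, (u j : ℂ) ^ 2)‖ = ∑ j, u j ^ 2 := by
    rw [norm_neg]
    have : (∑ j, (u j : ℂ) ^ 2) = ((∑ j, u j ^ 2 : ℝ) : ℂ) := by push_cast; rfl
    rw [this, Complex.norm_real, Real.norm_of_nonneg hS]
  refine add_le_add ?_ ?_
  · rw [norm_mul, h1]
    gcongr
    exact norm_fst_le q
  · refine (norm_sum_le _ _).trans ?_
    have : ∀ j ∈ Finset.univ, ‖2 * (u j : ℂ) * q.2 j‖ ≤ 2 * √(∑ j, u j ^ 2) * ‖q‖ := by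
      intro j _
      simp only [norm_mul, Complex.norm_real, Complex.norm_ofNat, Real.norm_eq_abs]
      have := abs_coord_le u j
      have h2 : ‖q.2 j‖ ≤ ‖q‖ := (norm_le_pi_norm q.2 j).trans (norm_snd_le q)
      gcongr
    refine (Finset.sum_le_card_nsmul _ _ _ this).trans (le_of_eq ?_)
    simp; ring

theorem lapFun_re (d : ℕ) (u : Fin d → ℝ) (q : ℂ × (Fin d → ℂ)) :
    (lapFun d u q).re ≤ -q.1.re * (∑ j, u j ^ 2) + 2 * d * ‖q‖ * √(∑ j, u j ^ 2) := by
  rw [lapFun_apply, Complex.add_re]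
  refine add_le_add (le_of_eq ?_) ?_
  · have : (∑ j, (u j : ℂ) ^ 2) = ((∑ j, u j ^ 2 : ℝ) : ℂ) := by push_cast; rfl
    rw [this, ← Complex.ofReal_neg, Complex.re_ofReal_mul]; ring
  · refine (Complex.re_le_norm _).trans ((norm_sum_le _ _).trans ?_)
    have : ∀ j ∈ Finset.univ, ‖2 * (u j : ℂ) * q.2 j‖ ≤ 2 * √(∑ j, u j ^ 2) * ‖q‖ := by
      intro j _
      simp only [norm_mul, Complex.norm_real, Complex.norm_ofNat, Real.norm_eq_abs]
      have := abs_coord_le u j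
      have h2 : ‖q.2 j‖ ≤ ‖q‖ := (norm_le_pi_norm q.2 j).trans (norm_snd_le q)
      gcongr
    refine (Finset.sum_le_card_nsmul _ _ _ this).trans (le_of_eq ?_)
    simp; ring

theorem lap_integrable (d : ℕ) (h : (Fin d → ℝ) → ℝ) (hmeas : Measurable h)
    (a : ℝ) (ha : 0 ≤ a) (m : ℕ)
    (hgrowth : ∀ u, |h u| ≤ a * (1 + Real.sqrt (∑ j, u j ^ 2)) ^ m)
    (q : ℂ × (Fin d → ℂ)) (hq : 0 < q.1.re) :
    Integrable (fun u => ‖(h u : ℂ) * Complex.exp (lapFun d u q)‖ *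
      Real.exp (q.1.re / 2 * ‖lapFun d u‖)) := by
  set σ := q.1.re with hσ
  set C : ℝ := m + 2 * d * ‖q‖ + σ * d with hC
  have hg : Integrable (fun u : Fin d → ℝ => a * Real.exp (C ^ 2 / σ) *
      Real.exp (-(σ / 4) * ∑ j, u j ^ 2)) := by
    have := (GaussianFourier.integrable_cexp_neg_mul_sum_add (ι := Fin d) (b := ((σ / 4 : ℝ) : ℂ))
      (by simpa using hq) 0).norm
    refine Integrable.const_mul ?_ _
    refine this.congr (Filter.Eventually.of_forall fun u => ?_)
    simp only [Complex.norm_exp]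
    congr 1
    have : (∑ j, (u j : ℂ) ^ 2) = ((∑ j, u j ^ 2 : ℝ) : ℂ) := by push_cast; rfl
    simp only [Pi.zero_apply, zero_mul, Finset.sum_const_zero, add_zero]
    rw [this, ← Complex.ofReal_neg, ← Complex.ofReal_mul, Complex.ofReal_re]
  refine hg.mono' ?_ (Filter.Eventually.of_forall fun u => ?_)
  · have h1 : Continuous fun u => Complex.exp (lapFun d u q) := by
      have := lapFun_continuous d
      fun_prop
    have h2 : Continuous fun u => Real.exp (σ / 2 * ‖lapFun d u‖) := by
      have := lapFun_continuous d
      fun_prop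
    exact (((Complex.measurable_ofReal.comp hmeas).mul h1.measurable).norm.mul
      h2.measurable).aestronglyMeasurable
  · rw [Real.norm_of_nonneg (by positivity), norm_mul, Complex.norm_exp, Complex.norm_real,
      Real.norm_eq_abs]
    have hS : 0 ≤ ∑ j, u j ^ 2 := Finset.sum_nonneg fun i _ => sq_nonneg _
    have hre := lapFun_re d u q
    have hn := lapFun_norm d u
    have hh := hgrowth u
    set S := ∑ j, u j ^ 2 with hSdef
    set R := √S with hR
    have hR0 : 0 ≤ R := Real.sqrt_nonneg _
    have hRS : S = R ^ 2 := (Real.sq_sqrt hS).symm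
    have hpow : (1 + R) ^ m ≤ Real.exp (m * R) := by
      rw [Real.exp_nat_mul]
      gcongr
      linarith [Real.add_one_le_exp R]
    calc |h u| * Real.exp (lapFun d u q).re * Real.exp (σ / 2 * ‖lapFun d u‖)
        ≤ (a * Real.exp (m * R)) * Real.exp (-σ * S + 2 * d * ‖q‖ * R) *
          Real.exp (σ / 2 * (S + 2 * d * R)) := by
          gcongr
          exact hh.trans (by gcongr)
      _ = a * Real.exp (C * R - σ / 2 * S) := by
          rw [mul_assoc, mul_assoc, ← Real.exp_add, ← Real.exp_add]
          congr 2
          rw [hC]; ring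
      _ ≤ a * Real.exp (C ^ 2 / σ + -(σ / 4) * S) := by
          gcongr
          have : C ^ 2 / σ + -(σ / 4) * S - (C * R - σ / 2 * S) = (C - σ * R / 2) ^ 2 / σ := by
            rw [hRS]; field_simp; ring
          have h0 : 0 ≤ (C - σ * R / 2) ^ 2 / σ := by positivity
          linarith
      _ = _ := by rw [Real.exp_add]; ring

/-- Change of variables linearising the exponent. -/
noncomputable def lapPt (d : ℕ) (T : ℝ) (p : ℂ × (Fin d → ℂ)) : ℂ × (Fin d → ℂ) :=
  (1 / (2 * ((T : ℂ) - p.1)), fun j => 1 / (2 * ((T : ℂ) - p.1)) * p.2 j)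

theorem lapPt_re (d : ℕ) (T : ℝ) (p : ℂ × (Fin d → ℂ)) (hp : p.1.re < T) :
    0 < (lapPt d T p).1.re := by
  have h1 : 0 < (2 * ((T : ℂ) - p.1)).re := by
    simp; linarith
  simp only [lapPt, one_div, Complex.inv_re]
  refine div_pos h1 (Complex.normSq_pos.2 fun h0 => ?_)
  rw [h0] at h1; simp at h1

theorem kernel_eq (d : ℕ) (T : ℝ) (p : ℂ × (Fin d → ℂ)) (u : Fin d → ℝ) :
    Complex.exp (-(∑ j, ((u j : ℂ) - p.2 j) ^ 2) / (2 * ((T : ℂ) - p.1))) =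
      Complex.exp (lapFun d u (lapPt d T p)) *
        Complex.exp (-(∑ j, (p.2 j) ^ 2) * (1 / (2 * ((T : ℂ) - p.1)))) := by
  rw [← Complex.exp_add, lapFun_apply]
  congr 1
  simp only [lapPt]
  generalize hs : 1 / (2 * ((T : ℂ) - p.1)) = s
  rw [div_eq_mul_one_div, hs]
  simp only [← Finset.sum_neg_distrib, Finset.sum_mul, ← Finset.sum_add_distrib]
  refine Finset.sum_congr rfl fun j _ => ?_
  ring

/-- Complex extension of the Gaussian convolution (Section 4.1 of the paper).
On the domain `Ω` of complexified time-space points `(t+iτ, x+iy)` with `0 < t < T`,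
`|τ| < T−t`, `|y| < √(T−t)`, the integral defining `V` converges absolutely, `V` is
holomorphic on `Ω`, and `V` agrees with `v` on real points. -/
theorem stmt_6 (d : ℕ) (hd : 1 ≤ d) (T : ℝ) (hT : 0 < T)
    (h : (Fin d → ℝ) → ℝ) (hmeas : Measurable h)
    (a : ℝ) (ha : 0 ≤ a) (m : ℕ)
    (hgrowth : ∀ u, |h u| ≤ a * (1 + Real.sqrt (∑ j, u j ^ 2)) ^ m)
    (v : ℝ × (Fin d → ℝ) → ℝ)
    (hv : ∀ t ∈ Ioo 0 T, ∀ x : Fin d → ℝ,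
      v (t, x) = (2 * π * (T - t)) ^ (-(d : ℝ) / 2) *
        ∫ u : Fin d → ℝ, h u * Real.exp (-(∑ j, (u j - x j) ^ 2) / (2 * (T - t))))
    (Ω : Set (ℂ × (Fin d → ℂ)))
    (hΩ : Ω = {p : ℂ × (Fin d → ℂ) | 0 < p.1.re ∧ p.1.re < T ∧ |p.1.im| < T - p.1.re ∧
      Real.sqrt (∑ j, (p.2 j).im ^ 2) < Real.sqrt (T - p.1.re)})
    (V : ℂ × (Fin d → ℂ) → ℂ)
    (hV : ∀ p ∈ Ω, V p = (2 * (π : ℂ) * ((T : ℂ) - p.1)) ^ (-(d : ℂ) / 2) *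
        ∫ u : Fin d → ℝ, (h u : ℂ) *
          Complex.exp (-(∑ j, ((u j : ℂ) - p.2 j) ^ 2) / (2 * ((T : ℂ) - p.1)))) :
    (∀ p ∈ Ω, Integrable (fun u : Fin d → ℝ => (h u : ℂ) *
        Complex.exp (-(∑ j, ((u j : ℂ) - p.2 j) ^ 2) / (2 * ((T : ℂ) - p.1))))) ∧
      AnalyticOnNhd ℂ V Ω ∧
      ∀ t ∈ Ioo 0 T, ∀ x : Fin d → ℝ,
        V ((t : ℂ), fun j => (x j : ℂ)) = (v (t, x) : ℂ) := by
  have hmem : ∀ p ∈ Ω, p.1.re < T := by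
    intro p hp
    rw [hΩ] at hp
    exact hp.2.1
  have hopen : IsOpen Ω := by
    rw [hΩ]
    refine IsOpen.and ?_ (IsOpen.and ?_ (IsOpen.and ?_ ?_)) <;>
      exact isOpen_lt (by fun_prop) (by fun_prop)
  refine ⟨?_, ?_, ?_⟩
  · intro p hp
    have hq := lapPt_re d T p (hmem p hp)
    have h0 := lap_integrable d h hmeas a ha m hgrowth _ hq
    have h1 : Integrable fun u => (h u : ℂ) * Complex.exp (lapFun d u (lapPt d T p)) := by
      refine h0.mono' ?_ (Filter.Eventually.of_forall fun u => ?_)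
      · have h1 : Continuous fun u => Complex.exp (lapFun d u (lapPt d T p)) := by
          have := lapFun_continuous d
          fun_prop
        exact ((Complex.measurable_ofReal.comp hmeas).mul h1.measurable).aestronglyMeasurable
      · refine le_mul_of_one_le_right (norm_nonneg _) (Real.one_le_exp ?_)
        positivity
    simp only [kernel_eq, ← mul_assoc]
    exact h1.mul_const _
  · intro p hp
    have hpT := hmem p hp
    have hq := lapPt_re d T p hpT
    have hW := laplace_analyticAt (fun u => (h u : ℂ)) (Complex.measurable_ofReal.comp hmeas)
      (lapFun d) (lapFun_continuous d) (lapPt d T p) _ (half_pos hq)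
      (lap_integrable d h hmeas a ha m hgrowth _ hq)
    have hre : 0 < ((T : ℂ) - p.1).re := by simp; linarith
    have hne : 2 * ((T : ℂ) - p.1) ≠ 0 := by
      intro h0
      have := congrArg Complex.re h0
      simp at this
      linarith
    have hsub : AnalyticAt ℂ (fun p : ℂ × (Fin d → ℂ) => (T : ℂ) - p.1) p :=
      analyticAt_const.sub analyticAt_fst
    have hs : AnalyticAt ℂ (fun p : ℂ × (Fin d → ℂ) => 1 / (2 * ((T : ℂ) - p.1))) p :=
      analyticAt_const.div (analyticAt_const.mul hsub) hne
    have hcoord : ∀ j, AnalyticAt ℂ (fun p : ℂ × (Fin d → ℂ) => p.2 j) p := fun j =>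
      ((ContinuousLinearMap.proj (R := ℂ) (φ := fun _ : Fin d => ℂ) j).comp
        (ContinuousLinearMap.snd ℂ ℂ (Fin d → ℂ))).analyticAt p
    have hPt : AnalyticAt ℂ (lapPt d T) p := by
      refine hs.prod (AnalyticAt.pi fun j => hs.mul (hcoord j))
    have hpre : AnalyticAt ℂ
        (fun p : ℂ × (Fin d → ℂ) => (2 * (π : ℂ) * ((T : ℂ) - p.1)) ^ (-(d : ℂ) / 2)) p := by
      refine (analyticAt_const.mul hsub).cpow analyticAt_const (Or.inl ?_)
      have : (2 * (π : ℂ) * ((T : ℂ) - p.1)) = ((2 * π : ℝ) : ℂ) * ((T : ℂ) - p.1) := by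
        push_cast; rfl
      change 0 < (2 * (π : ℂ) * ((T : ℂ) - p.1)).re
      rw [this, Complex.re_ofReal_mul]
      have := Real.pi_pos
      positivity
    have hE : AnalyticAt ℂ (fun p : ℂ × (Fin d → ℂ) =>
        Complex.exp (-(∑ j, (p.2 j) ^ 2) * (1 / (2 * ((T : ℂ) - p.1))))) p := by
      refine AnalyticAt.cexp (AnalyticAt.mul (AnalyticAt.neg ?_) hs)
      exact Finset.analyticAt_fun_sum _ fun j _ => (hcoord j).pow 2
    have hall := hpre.mul ((hW.comp hPt).mul hE)
    refine hall.congr ?_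
    filter_upwards [hopen.mem_nhds hp] with z hz
    rw [hV z hz]
    simp only [Pi.mul_apply, Function.comp_apply, kernel_eq, ← mul_assoc, integral_mul_const]
  · intro t ht x
    have hp : ((t : ℂ), fun j => (x j : ℂ)) ∈ Ω := by
      rw [hΩ]
      simp only [mem_setOf_eq, Complex.ofReal_re, Complex.ofReal_im, abs_zero]
      refine ⟨ht.1, ht.2, by linarith [ht.2], ?_⟩
      simp only [ne_eq, OfNat.ofNat_ne_zero, not_false_eq_true, zero_pow, Finset.sum_const_zero,
        Real.sqrt_zero]
      exact Real.sqrt_pos.2 (by linarith [ht.2])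
    rw [hV _ hp, hv t ht x, Complex.ofReal_mul, ← integral_complex_ofReal,
      Complex.ofReal_cpow (by have := Real.pi_pos; have := ht.2; have : 0 < T - t := by linarith
                              positivity)]
    push_cast
    rfl
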